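/- Let (p_1,…,p_n) be a parking function of length n. Then each of the following tuples is a parking function of length n+1: (i) (p_1,…,p_n,p_n); (ii) (p_1,…,p_n,n+1); (iii) (p_1+1, p_2+1, …, p_n+1, 1). Moreover, (i) ends in a tie, (ii) ends in an ascent, and (iii) ends in a descent, while in all three cases the comparison pattern (ascent/descent/tie) between consecutive entries among the first n positions is unchanged. -/

import Mathlib

/-- `f : Fin n → Fin n` (entries 0-indexed, value `v` encodes preference `v+1`) is a
parking function: some rearrangement `f ∘ σ` is nondecreasing and its `i`-th entry
(0-indexed) is at most `i`. -/
def IsPF {n : ℕ} (f : Fin n → Fin n) : Prop :=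
  ∃ σ : Equiv.Perm (Fin n), Monotone (f ∘ σ) ∧ ∀ i : Fin n, (f (σ i) : ℕ) ≤ (i : ℕ)

/-- The comparison pattern (ascent/descent/tie) between consecutive entries among the
first `n` positions of `q : Fin (n+1) → Fin (n+1)` agrees with that of
`p : Fin n → Fin n`. -/
def SamePattern {n : ℕ} (p : Fin n → Fin n) (q : Fin (n + 1) → Fin (n + 1)) : Prop :=
  ∀ i : ℕ, ∀ h : i + 1 < n,
    ((p ⟨i, by omega⟩ < p ⟨i + 1, h⟩ ↔ q ⟨i, by omega⟩ < q ⟨i + 1, by omega⟩) ∧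
     (p ⟨i + 1, h⟩ < p ⟨i, by omega⟩ ↔ q ⟨i + 1, by omega⟩ < q ⟨i, by omega⟩) ∧
     (p ⟨i, by omega⟩ = p ⟨i + 1, h⟩ ↔ q ⟨i, by omega⟩ = q ⟨i + 1, by omega⟩))

theorem IsPF.of_injective {n : ℕ} {f g : Fin n → Fin n} (hg : Function.Injective g)
    (h : ∀ i, (f (g i) : ℕ) ≤ i) : IsPF f := by
  refine ⟨Tuple.sort f, Tuple.monotone_sort f, fun i => ?_⟩
  by_contra! hi
  have hmaps : ∀ j ∈ Finset.Iic i, (Tuple.sort f).symm (g j) ∈ Finset.Iio i := by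
    intro j hj
    rw [Finset.mem_Iic] at hj
    rw [Finset.mem_Iio]
    by_contra! hle
    have hmono := Tuple.monotone_sort f hle
    simp only [Function.comp_apply, Equiv.apply_symm_apply] at hmono
    have := h j
    rw [Fin.le_def] at hj hmono
    omega
  have hcard := Finset.card_le_card_of_injOn _ hmaps
    (((Tuple.sort f).symm.injective.comp hg).injOn)
  simp at hcard

theorem IsPF.snoc_castSucc {n : ℕ} {p : Fin n → Fin n} (hp : IsPF p) (x : Fin (n + 1)) :
    IsPF (Fin.snoc (fun i => (p i).castSucc) x : Fin (n + 1) → Fin (n + 1)) := by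
  obtain ⟨σ, -, hσ⟩ := hp
  refine IsPF.of_injective
    (g := Fin.snoc (fun i => (σ i).castSucc) (Fin.last n)) ?_ fun i => ?_
  · refine Fin.snoc_injective_iff.2 ⟨(Fin.castSucc_injective n).comp σ.injective, ?_⟩
    rintro ⟨i, hi⟩
    exact (Fin.castSucc_lt_last _).ne hi
  · induction i using Fin.lastCases with
    | last => simpa using x.is_le
    | cast i => simpa using hσ i

theorem IsPF.snoc_succ_zero {n : ℕ} {p : Fin n → Fin n} (hp : IsPF p) :
    IsPF (Fin.snoc (fun i => (p i).succ) 0 : Fin (n + 1) → Fin (n + 1)) := by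
  obtain ⟨σ, -, hσ⟩ := hp
  refine IsPF.of_injective
    (g := Fin.cons (Fin.last n) fun i => (σ i).castSucc) ?_ fun i => ?_
  · refine Fin.cons_injective_iff.2 ⟨?_, (Fin.castSucc_injective n).comp σ.injective⟩
    rintro ⟨i, hi⟩
    exact (Fin.castSucc_lt_last _).ne hi
  · induction i using Fin.cases with
    | zero => simp
    | succ i => simpa using hσ i

theorem SamePattern.snoc_of_strictMono {n : ℕ} (p : Fin n → Fin n)
    {e : Fin n → Fin (n + 1)} (he : StrictMono e) (x : Fin (n + 1)) :
    SamePattern p (Fin.snoc (fun i => e (p i)) x) := by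
  intro i h
  have hsnoc (j : ℕ) (hj : j < n) :
      (Fin.snoc (fun i => e (p i)) x : Fin (n + 1) → Fin (n + 1)) ⟨j, by omega⟩ = e (p ⟨j, hj⟩) :=
    Fin.snoc_castSucc (α := fun _ => Fin (n + 1)) x (fun i => e (p i)) ⟨j, hj⟩
  rw [hsnoc i (by omega), hsnoc (i + 1) h]
  exact ⟨he.lt_iff_lt.symm, he.lt_iff_lt.symm, he.injective.eq_iff.symm⟩

/-- Appending the last preference again, appending the preference `n+1`, or incrementing
all preferences and appending the preference `1`, turns a parking function of length `n`
into one of length `n+1`, ending respectively in a tie, an ascent, and a descent, while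
leaving the comparison pattern among the first `n` entries unchanged. -/
theorem stmt16 (n : ℕ) (hn : 1 ≤ n) (p : Fin n → Fin n) (hp : IsPF p) :
    (∀ q : Fin (n + 1) → Fin (n + 1),
      q = Fin.snoc (fun i => (p i).castSucc) ((p ⟨n - 1, by omega⟩).castSucc) →
        IsPF q ∧ q ⟨n - 1, by omega⟩ = q ⟨n, by omega⟩ ∧ SamePattern p q) ∧
    (∀ q : Fin (n + 1) → Fin (n + 1),
      q = Fin.snoc (fun i => (p i).castSucc) (Fin.last n) →
        IsPF q ∧ q ⟨n - 1, by omega⟩ < q ⟨n, by omega⟩ ∧ SamePattern p q) ∧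
    (∀ q : Fin (n + 1) → Fin (n + 1),
      q = Fin.snoc (fun i => (p i).succ) (⟨0, by omega⟩ : Fin (n + 1)) →
        IsPF q ∧ q ⟨n, by omega⟩ < q ⟨n - 1, by omega⟩ ∧ SamePattern p q) := by
  have hprev (r : Fin n → Fin (n + 1)) (x : Fin (n + 1)) :
      (Fin.snoc r x : Fin (n + 1) → Fin (n + 1)) ⟨n - 1, by omega⟩ = r ⟨n - 1, by omega⟩ :=
    Fin.snoc_castSucc (α := fun _ => Fin (n + 1)) x r ⟨n - 1, by omega⟩
  have hlast (r : Fin n → Fin (n + 1)) (x : Fin (n + 1)) :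
      (Fin.snoc r x : Fin (n + 1) → Fin (n + 1)) ⟨n, by omega⟩ = x :=
    Fin.snoc_last (α := fun _ => Fin (n + 1)) x r
  refine ⟨?_, ?_, ?_⟩
  · rintro q rfl
    refine ⟨hp.snoc_castSucc _, ?_, .snoc_of_strictMono p Fin.strictMono_castSucc _⟩
    rw [hprev, hlast]
  · rintro q rfl
    refine ⟨hp.snoc_castSucc _, ?_, .snoc_of_strictMono p Fin.strictMono_castSucc _⟩
    rw [hprev, hlast]
    exact Fin.castSucc_lt_last _
  · rintro q rfl
    refine ⟨hp.snoc_succ_zero, ?_, .snoc_of_strictMono p Fin.strictMono_succ _⟩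
    rw [hprev, hlast]
    exact Fin.succ_pos _
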